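/- Let (c^(N))_{N≥2} be a family of conductances satisfying condition (LLN). For each N, let g_N : {1,…,N} → ℝ satisfy Δ^{c^(N)} g_N = −gap_N·g_N and g_N(1) = 1, let h_N(x) := cos(π·(x − 1/2)/N), let α_N := N²·gap_N, and let τ₁^(N) := min{ x ∈ {1,…,N} : √(α_N)·r^(N)(1,x)/N ≥ π/4 } (with the immaterial convention τ₁^(N) := N if the set is empty). Then lim_{N→∞} max_{1 ≤ x ≤ τ₁^(N)} |g_N(x) − h_N(x)| = 0 and lim_{N→∞} max_{2 ≤ x ≤ τ₁^(N)} |N·c^(N)(x−1)·(g_N(x) − g_N(x−1)) − N·(h_N(x) − h_N(x−1))| = 0. -/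

import Mathlib

/-- The generator `Δ^c` of the random walk with conductances `c` on `⟦1, N⟧`. -/
def gen (N : ℕ) (c : ℕ → ℝ) (f : ℕ → ℝ) (x : ℕ) : ℝ :=
  (if x < N then c x * (f (x + 1) - f x) else 0) +
  (if 2 ≤ x then c (x - 1) * (f (x - 1) - f x) else 0)

/-- `lam` is an eigenvalue of `−Δ^c`. -/
def IsEigenvalue (N : ℕ) (c : ℕ → ℝ) (lam : ℝ) : Prop :=
  ∃ f : ℕ → ℝ, (∃ x ∈ Finset.Icc 1 N, f x ≠ 0) ∧
    ∀ x ∈ Finset.Icc 1 N, gen N c f x = -lam * f x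

/-- The spectral gap: the smallest strictly positive eigenvalue of `−Δ^c`. -/
noncomputable def spectralGap (N : ℕ) (c : ℕ → ℝ) : ℝ :=
  sInf {lam : ℝ | 0 < lam ∧ IsEigenvalue N c lam}

/-- `rsum r n m = Σ_{x=n}^{m-1} r(x)`. -/
def rsum (r : ℕ → ℝ) (n m : ℕ) : ℝ := ∑ x ∈ Finset.Ico n m, r x

/-- Condition (LLN): `(1/N)·sup_{1 ≤ n < m ≤ N} |r^{(N)}(n,m) − (m−n)| → 0`. -/
def LLN (r : ℕ → ℕ → ℝ) : Prop :=
  ∀ ε > (0 : ℝ), ∃ N₀ : ℕ, ∀ N ≥ N₀, ∀ n m : ℕ, 1 ≤ n → n < m → m ≤ N →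
    |rsum (r N) n m - ((m : ℝ) - (n : ℝ))| ≤ ε * N

/-- `h_N(x) = cos(π(x − 1/2)/N)`. -/
noncomputable def hfun (N : ℕ) (x : ℕ) : ℝ := Real.cos (Real.pi * ((x : ℝ) - 1/2) / N)

open Classical in
/-- `τ₁ = min{x ∈ ⟦1,N⟧ : √α·r(1,x)/N ≥ π/4}`, with convention `N` if the set is empty. -/
noncomputable def tau1 (N : ℕ) (r : ℕ → ℝ) (α : ℝ) : ℕ :=
  if h : ((Finset.Icc 1 N).filter
      (fun x => Real.pi / 4 ≤ Real.sqrt α * rsum r 1 x / N)).Nonempty then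
    ((Finset.Icc 1 N).filter
      (fun x => Real.pi / 4 ≤ Real.sqrt α * rsum r 1 x / N)).min' h
  else N

lemma aux_repr (N : ℕ) (u r : ℕ → ℝ) (k : ℝ)
    (h : ∀ x, 1 ≤ x → x < N → u (x+1) = u x - k * r x * ∑ z ∈ Finset.Ico 1 (x+1), u z) :
    ∀ x, 1 ≤ x → x ≤ N → u x = u 1 - k * ∑ z ∈ Finset.Ico 1 x, rsum r z x * u z := by
  intro x hx
  induction x, hx using Nat.le_induction with
  | base => intro _; simp
  | succ x hx ih =>
    intro hN
    have e : ∑ z ∈ Finset.Ico 1 (x+1), rsum r z (x+1) * u z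
        = ∑ z ∈ Finset.Ico 1 x, rsum r z x * u z + r x * ∑ z ∈ Finset.Ico 1 (x+1), u z := by
      have e1 : ∑ z ∈ Finset.Ico 1 (x+1), rsum r z (x+1) * u z
        = ∑ z ∈ Finset.Ico 1 (x+1), (rsum r z x * u z + r x * u z) := by
        apply Finset.sum_congr rfl
        intro z hz
        rw [Finset.mem_Ico] at hz
        rw [rsum, Finset.sum_Ico_succ_top (by omega), rsum]; ring
      rw [e1, Finset.sum_add_distrib, ← Finset.mul_sum, Finset.sum_Ico_succ_top (by omega)]
      simp [rsum]
    rw [h x hx (by omega), ih (by omega), e]; ring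

lemma aux_gron (N : ℕ) (a : ℕ → ℝ) (A B : ℝ) (hA : 0 ≤ A) (hB : 0 ≤ B)
    (h : ∀ x, 1 ≤ x → x ≤ N → a x ≤ A + B * ∑ z ∈ Finset.Ico 1 x, a z) :
    ∀ x, 1 ≤ x → x ≤ N → a x ≤ A * Real.exp (B * N) := by
  have key : ∀ x, 1 ≤ x → x ≤ N → A + B * ∑ z ∈ Finset.Ico 1 x, a z ≤ A * (1+B)^x := by
    intro x hx
    induction x, hx using Nat.le_induction with
    | base => intro _; simp; nlinarith
    | succ x hx ih =>
      intro hN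
      rw [Finset.sum_Ico_succ_top (by omega), pow_succ]
      have h1 := h x hx (by omega)
      have h2 := ih (by omega)
      nlinarith [mul_le_mul_of_nonneg_left h1 hB, mul_le_mul_of_nonneg_left h2 (by linarith : 0 ≤ 1+B)]
  intro x hx hN
  refine (h x hx hN).trans ((key x hx hN).trans ?_)
  apply mul_le_mul_of_nonneg_left _ hA
  calc (1+B)^x ≤ (1+B)^N := pow_le_pow_right₀ (by linarith) hN
    _ ≤ (Real.exp B)^N := by
        apply pow_le_pow_left₀ (by linarith)
        linarith [Real.add_one_le_exp B]
    _ = _ := by rw [← Real.exp_nat_mul]; ring_nf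

lemma aux_Dsum (t : ℝ) (x : ℕ) :
    2 * Real.sin (t/2) * ∑ z ∈ Finset.Ico 1 (x+1), Real.cos (t * ((z:ℝ) - 1/2)) = Real.sin (t * x) := by
  induction x with
  | zero => simp
  | succ x ih =>
    rw [Finset.sum_Ico_succ_top (by omega), mul_add, ih]
    push_cast
    have e1 : t * x = t * (x + 1 - 1/2) - t/2 := by ring
    have e2 : t * (x+1) = t * (x + 1 - 1/2) + t/2 := by ring
    rw [e1, e2, Real.sin_add, Real.sin_sub]; ring

lemma aux_kappa (t : ℝ) : 2 - 2 * Real.cos t = 4 * Real.sin (t/2)^2 := by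
  have : t = 2 * (t/2) := by ring
  rw [this, Real.cos_two_mul, Real.cos_sq']; ring_nf

lemma aux_Dstep (t : ℝ) (x : ℕ) : Real.cos (t * (((x+1 : ℕ):ℝ) - 1/2))
    = Real.cos (t * ((x:ℝ) - 1/2)) - 2 * Real.sin (t/2) * Real.sin (t * x) := by
  push_cast
  have e1 : t * ((x:ℝ) - 1/2) = t * x - t/2 := by ring
  have e2 : t * ((x:ℝ) + 1 - 1/2) = t * x + t/2 := by ring
  rw [e1, e2, Real.cos_add, Real.cos_sub]; ring

lemma aux_Drec (t : ℝ) (x : ℕ) : Real.cos (t * (((x+1 : ℕ):ℝ) - 1/2))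
    = Real.cos (t * ((x:ℝ) - 1/2)) - (2 - 2 * Real.cos t) * (1:ℝ) *
      ∑ z ∈ Finset.Ico 1 (x+1), Real.cos (t * ((z:ℝ) - 1/2)) := by
  rw [aux_Dstep, aux_kappa, ← aux_Dsum]; ring

lemma aux_kappa_le (N : ℕ) (hN : 2 ≤ N) (p : ℝ) (hp0 : 0 ≤ p) (hp : p ≤ 4) :
    0 ≤ 2 - 2 * Real.cos (p / N) ∧ (2 - 2 * Real.cos (p / N)) * (N:ℝ)^2 ≤ 16 := by
  have hN' : (0:ℝ) < N := by positivity
  refine ⟨by linarith [Real.cos_le_one (p/N)], ?_⟩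
  have h1 := Real.one_sub_sq_div_two_le_cos (x := p/N)
  have h2 : 2 - 2 * Real.cos (p / N) ≤ (p/N)^2 := by linarith
  calc _ ≤ (p/N)^2 * (N:ℝ)^2 := by gcongr
    _ = p^2 := by field_simp
    _ ≤ 16 := by nlinarith

/-- uniform comparison -/
lemma aux_cmp (N : ℕ) (hN : 2 ≤ N) (u r : ℕ → ℝ) (p e : ℝ) (hp0 : 0 ≤ p) (hp : p ≤ 4)
    (he0 : 0 ≤ e) (he : e ≤ 1)
    (hr : ∀ n m : ℕ, 1 ≤ n → n < m → m ≤ N → |rsum r n m - ((m : ℝ) - (n : ℝ))| ≤ e * N)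
    (hu1 : u 1 = 1)
    (hu : ∀ x, 1 ≤ x → x < N → u (x+1) = u x - (2 - 2 * Real.cos (p/N)) * r x *
      ∑ z ∈ Finset.Ico 1 (x+1), u z) :
    ∀ x, 1 ≤ x → x ≤ N →
      |Real.cos (p/N/2) * u x - Real.cos (p/N * ((x:ℝ) - 1/2))| ≤ (16 * Real.exp 32) * e := by
  obtain ⟨hk0, hk⟩ := aux_kappa_le N hN p hp0 hp
  have hN' : (0:ℝ) < N := by positivity
  set t := p / N with ht
  set k := 2 - 2 * Real.cos t with hkd
  have R1 := aux_repr N u r k hu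
  have R2 := aux_repr N (fun x => Real.cos (t * ((x:ℝ) - 1/2))) (fun _ => 1) k
    (fun x _ _ => aux_Drec t x)
  have hB : k * (2 * N) ≤ 32 / N := by
    rw [le_div_iff₀ hN']; nlinarith
  have := aux_gron N (fun x => |Real.cos (t/2) * u x - Real.cos (t * ((x:ℝ) - 1/2))|) (16 * e) (32/N)
    (by positivity) (by positivity) ?_
  · intro x hx hxN
    refine (this x hx hxN).trans (le_of_eq ?_)
    rw [div_mul_cancel₀ _ hN'.ne']; ring
  intro x hx hxN
  have hD1 : Real.cos (t * (((1:ℕ):ℝ) - 1/2)) = Real.cos (t/2) := by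
    congr 1; push_cast; ring
  have E : Real.cos (t/2) * u x - Real.cos (t * ((x:ℝ) - 1/2)) =
      - k * ∑ z ∈ Finset.Ico 1 x, (rsum r z x * (Real.cos (t/2) * u z - Real.cos (t * ((z:ℝ) - 1/2)))
        + (rsum r z x - ((x:ℝ) - z)) * Real.cos (t * ((z:ℝ) - 1/2))) := by
    have e1 := R1 x hx hxN
    have e2 := R2 x hx hxN
    simp only [hD1] at e2
    rw [e2, e1, hu1]
    have : ∑ z ∈ Finset.Ico 1 x, rsum (fun _ => (1:ℝ)) z x * Real.cos (t * ((z:ℝ) - 1/2))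
      = ∑ z ∈ Finset.Ico 1 x, ((x:ℝ) - z) * Real.cos (t * ((z:ℝ) - 1/2)) := by
      apply Finset.sum_congr rfl
      intro z hz
      rw [Finset.mem_Ico] at hz
      simp [rsum, Nat.cast_sub hz.2.le]
    rw [this]
    have e3 : Real.cos (t/2) * ∑ z ∈ Finset.Ico 1 x, rsum r z x * u z
      = ∑ z ∈ Finset.Ico 1 x, Real.cos (t/2) * (rsum r z x * u z) := Finset.mul_sum _ _ _
    have e4 : ∑ z ∈ Finset.Ico 1 x, (rsum r z x * (Real.cos (t/2) * u z - Real.cos (t * ((z:ℝ) - 1/2)))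
        + (rsum r z x - ((x:ℝ) - z)) * Real.cos (t * ((z:ℝ) - 1/2)))
      = ∑ z ∈ Finset.Ico 1 x, Real.cos (t/2) * (rsum r z x * u z)
        - ∑ z ∈ Finset.Ico 1 x, ((x:ℝ) - z) * Real.cos (t * ((z:ℝ) - 1/2)) := by
      rw [← Finset.sum_sub_distrib]
      exact Finset.sum_congr rfl (fun z _ => by ring)
    rw [e4, ← e3]; ring
  rw [E, abs_mul, abs_neg, abs_of_nonneg hk0]
  set d : ℕ → ℝ := fun z => |Real.cos (t/2) * u z - Real.cos (t * ((z:ℝ) - 1/2))| with hd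
  have hb : ∀ z ∈ Finset.Ico 1 x, |rsum r z x * (Real.cos (t/2) * u z - Real.cos (t * ((z:ℝ) - 1/2)))
        + (rsum r z x - ((x:ℝ) - z)) * Real.cos (t * ((z:ℝ) - 1/2))| ≤ 2 * N * d z + e * N := by
    intro z hz
    rw [Finset.mem_Ico] at hz
    have h1 := hr z x hz.1 hz.2 hxN
    refine (abs_add_le _ _).trans ?_
    rw [abs_mul, abs_mul]
    have hzx : (z:ℝ) < x := by exact_mod_cast hz.2
    have hz1 : (1:ℝ) ≤ z := by exact_mod_cast hz.1
    have hxx : (x:ℝ) ≤ N := by exact_mod_cast hxN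
    have h2 : |rsum r z x| ≤ 2 * N := by
      rw [abs_le] at h1 ⊢
      constructor <;> nlinarith
    have h3 := mul_le_mul h1 (Real.abs_cos_le_one (t * ((z:ℝ) - 1/2))) (abs_nonneg _) (by positivity)
    have h4 := mul_le_mul_of_nonneg_right h2 (abs_nonneg (Real.cos (t/2) * u z - Real.cos (t * ((z:ℝ) - 1/2))))
    simp only [hd]
    linarith
  have hs := (Finset.abs_sum_le_sum_abs _ _).trans (Finset.sum_le_sum hb)
  have hs' : ∑ z ∈ Finset.Ico 1 x, (2 * N * d z + e * N)
      = 2 * N * ∑ z ∈ Finset.Ico 1 x, d z + ((x - 1 : ℕ):ℝ) * (e * N) := by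
    rw [Finset.sum_add_distrib, ← Finset.mul_sum, Finset.sum_const, Nat.card_Ico, nsmul_eq_mul]
  rw [hs'] at hs
  have hx' : ((x - 1 : ℕ):ℝ) ≤ N := by exact_mod_cast (by omega : x - 1 ≤ N)
  have hd0 : 0 ≤ ∑ z ∈ Finset.Ico 1 x, d z := Finset.sum_nonneg (fun _ _ => abs_nonneg _)
  calc _ ≤ k * (2 * N * ∑ z ∈ Finset.Ico 1 x, d z + N * (e * N)) := by
        apply mul_le_mul_of_nonneg_left _ hk0
        refine hs.trans ?_
        gcongr
    _ = (k * N^2) * e + k * (2 * N) * ∑ z ∈ Finset.Ico 1 x, d z := by ring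
    _ ≤ _ := by gcongr

lemma aux_gen_flux (N : ℕ) (c f : ℕ → ℝ) (lam : ℝ)
    (h : ∀ x ∈ Finset.Icc 1 N, gen N c f x = -lam * f x) :
    ∀ x, 1 ≤ x → x < N → c x * (f (x+1) - f x) = - lam * ∑ z ∈ Finset.Ico 1 (x+1), f z := by
  intro x hx
  induction x, hx using Nat.le_induction with
  | base =>
    intro h1
    have := h 1 (Finset.mem_Icc.2 ⟨le_rfl, h1.le⟩)
    simpa [gen, h1] using this
  | succ x hx ih =>
    intro hN
    have := h (x+1) (Finset.mem_Icc.2 ⟨by omega, hN.le⟩)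
    have h2 : 2 ≤ x + 1 := by omega
    simp only [gen, hN, h2, if_true, Nat.add_sub_cancel] at this
    rw [Finset.sum_Ico_succ_top (by omega), mul_add, ← ih (by omega), ← this]; ring

lemma aux_gen_sum (N : ℕ) (hN : 2 ≤ N) (c f : ℕ → ℝ) (lam : ℝ)
    (h : ∀ x ∈ Finset.Icc 1 N, gen N c f x = -lam * f x) :
    lam * ∑ z ∈ Finset.Ico 1 (N+1), f z = 0 := by
  obtain ⟨M, rfl⟩ : ∃ M, N = M + 1 := ⟨N - 1, by omega⟩
  have h1 := aux_gen_flux (M+1) c f lam h M (by omega) (by omega)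
  have := h (M+1) (Finset.mem_Icc.2 ⟨by omega, le_rfl⟩)
  simp only [gen, hN, if_true, Nat.add_sub_cancel, lt_irrefl, if_false] at this
  rw [Finset.sum_Ico_succ_top (by omega), mul_add]
  linarith

/-- converse -/
lemma aux_gen_conv (N : ℕ) (hN : 2 ≤ N) (c f : ℕ → ℝ) (lam : ℝ)
    (h : ∀ x, 1 ≤ x → x < N → c x * (f (x+1) - f x) = - lam * ∑ z ∈ Finset.Ico 1 (x+1), f z)
    (h0 : ∑ z ∈ Finset.Ico 1 (N+1), f z = 0) :
    ∀ x ∈ Finset.Icc 1 N, gen N c f x = -lam * f x := by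
  intro x hx
  rw [Finset.mem_Icc] at hx
  have F : ∀ y, 1 ≤ y → y ≤ N → (if y < N then c y * (f (y + 1) - f y) else 0)
      = - lam * ∑ z ∈ Finset.Ico 1 (y+1), f z := by
    intro y h1 h2
    split_ifs with h3
    · exact h y h1 h3
    · obtain rfl : y = N := by omega
      rw [h0]; simp
  rw [gen, F x hx.1 hx.2]
  split_ifs with h2
  · obtain ⟨y, rfl⟩ : ∃ y, x = y + 1 := ⟨x - 1, by omega⟩
    have := h y (by omega) (by omega)
    rw [Nat.add_sub_cancel, Finset.sum_Ico_succ_top (by omega)]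
    linarith
  · obtain rfl : x = 1 := by omega
    simp

/-- shooting solution: value and partial sum, shifted by one -/
noncomputable def shoot (r : ℕ → ℝ) (lam : ℝ) : ℕ → ℝ × ℝ
  | 0 => (1, 1)
  | n + 1 => ((shoot r lam n).1 - lam * r (n+1) * (shoot r lam n).2,
      (shoot r lam n).2 + ((shoot r lam n).1 - lam * r (n+1) * (shoot r lam n).2))

lemma shoot_cont (r : ℕ → ℝ) (n : ℕ) : Continuous (fun lam => shoot r lam n) := by
  induction n with
  | zero => simp only [shoot]; exact continuous_const
  | succ n ih => simp only [shoot]; fun_prop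

lemma shoot_sum (r : ℕ → ℝ) (lam : ℝ) (n : ℕ) :
    ∑ z ∈ Finset.Ico 1 (n+2), (shoot r lam (z-1)).1 = (shoot r lam n).2 := by
  induction n with
  | zero => simp [shoot]
  | succ n ih =>
    rw [Finset.sum_Ico_succ_top (by omega), ih]
    simp [shoot]

lemma shoot_rec (r : ℕ → ℝ) (lam : ℝ) (x : ℕ) (hx : 1 ≤ x) :
    (shoot r lam (x+1-1)).1 = (shoot r lam (x-1)).1 - lam * r x *
      ∑ z ∈ Finset.Ico 1 (x+1), (shoot r lam (z-1)).1 := by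
  obtain ⟨y, rfl⟩ : ∃ y, x = y + 1 := ⟨x - 1, by omega⟩
  rw [shoot_sum]
  simp [shoot]

/-- the sum of the solution is close to that of the cosine -/
lemma aux_sum (N : ℕ) (hN : 2 ≤ N) (u : ℕ → ℝ) (p η : ℝ)
    (h : ∀ x, 1 ≤ x → x ≤ N →
      |Real.cos (p/N/2) * u x - Real.cos (p/N * ((x:ℝ) - 1/2))| ≤ η) :
    |Real.cos (p/N/2) * ∑ z ∈ Finset.Ico 1 (N+1), u z -
      ∑ z ∈ Finset.Ico 1 (N+1), Real.cos (p/N * ((z:ℝ) - 1/2))| ≤ N * η := by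
  rw [Finset.mul_sum, ← Finset.sum_sub_distrib]
  refine (Finset.abs_sum_le_sum_abs _ _).trans ?_
  refine (Finset.sum_le_sum (g := fun _ => η) ?_).trans (by simp)
  intro z hz
  rw [Finset.mem_Ico] at hz
  exact h z hz.1 (by omega)

lemma aux_ang (N : ℕ) (hN : 2 ≤ N) (p : ℝ) (hp0 : 0 < p) (hp : p ≤ 4) :
    0 < p/N/2 ∧ p/N/2 ≤ 1 ∧ 0 < Real.sin (p/N/2) ∧ 2 * Real.sin (p/N/2) * N ≤ p ∧
    0 < Real.cos (p/N/2) := by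
  have hN2 : (2:ℝ) ≤ N := by exact_mod_cast hN
  have h0 : 0 < p/N/2 := by positivity
  have h1 : p/N/2 ≤ 1 := by
    rw [div_div, div_le_one (by positivity)]; linarith
  have hpi := Real.pi_gt_three
  refine ⟨h0, h1, Real.sin_pos_of_pos_of_lt_pi h0 (by linarith), ?_,
    Real.cos_pos_of_mem_Ioo ⟨by linarith, by linarith⟩⟩
  have := Real.sin_le h0.le
  calc 2 * Real.sin (p/N/2) * N ≤ 2 * (p/N/2) * N := by gcongr
    _ = p := by field_simp

/-- positivity of the sum before `π - δ` -/
lemma aux_pos (N : ℕ) (hN : 2 ≤ N) (u : ℕ → ℝ) (p η δ : ℝ) (hp0 : 0 < p) (hδ : 0 < δ) (hδ1 : δ ≤ 1/2)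
    (hp : p ≤ Real.pi - δ) (hη0 : 0 ≤ η) (hη : η < Real.sin δ / 4)
    (h : ∀ x, 1 ≤ x → x ≤ N →
      |Real.cos (p/N/2) * u x - Real.cos (p/N * ((x:ℝ) - 1/2))| ≤ η) :
    0 < ∑ z ∈ Finset.Ico 1 (N+1), u z := by
  have hpi := Real.pi_gt_three
  have hpi' := Real.pi_lt_d2
  obtain ⟨a0, a1, a2, a3, a4⟩ := aux_ang N hN p hp0 (by linarith)
  have hN' : (0:ℝ) < N := by positivity
  have hs := aux_Dsum (p/N) N
  rw [div_mul_cancel₀ _ hN'.ne'] at hs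
  have hc := aux_sum N hN u p η h
  set S := ∑ z ∈ Finset.Ico 1 (N+1), u z
  set T := ∑ z ∈ Finset.Ico 1 (N+1), Real.cos (p/N * ((z:ℝ) - 1/2))
  have hsin : p * η < Real.sin p := by
    by_cases hq : p ≤ Real.pi / 2
    · have h1 := Real.mul_le_sin hp0.le hq
      have h2 := Real.sin_le_one δ
      have h3 : 1/2 ≤ 2 / Real.pi := by rw [div_le_div_iff₀ (by norm_num) (by linarith)]; linarith
      nlinarith
    · have h1 : Real.sin δ ≤ Real.sin p := by
        rw [← Real.sin_pi_sub p]
        apply Real.sin_le_sin_of_le_of_le_pi_div_two <;> linarith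
      nlinarith
  have h5 : N * η < T := by
    by_contra hcon
    push Not at hcon
    have : 2 * Real.sin (p/N/2) * T ≤ p * η := by
      calc 2 * Real.sin (p/N/2) * T ≤ 2 * Real.sin (p/N/2) * (N * η) := by gcongr
        _ = (2 * Real.sin (p/N/2) * N) * η := by ring
        _ ≤ _ := by gcongr
    linarith
  have h6 : 0 < Real.cos (p/N/2) * S := by rw [abs_le] at hc; linarith
  exact (mul_pos_iff_of_pos_left a4).1 h6

lemma aux_neg (N : ℕ) (hN : 2 ≤ N) (u : ℕ → ℝ) (p η δ : ℝ) (hδ : 0 < δ) (hδ1 : δ ≤ 1/2)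
    (hp : p = Real.pi + δ) (hη0 : 0 ≤ η) (hη : η < Real.sin δ / 4)
    (h : ∀ x, 1 ≤ x → x ≤ N →
      |Real.cos (p/N/2) * u x - Real.cos (p/N * ((x:ℝ) - 1/2))| ≤ η) :
    ∑ z ∈ Finset.Ico 1 (N+1), u z < 0 := by
  have hpi := Real.pi_gt_three
  have hpi' := Real.pi_lt_d2
  obtain ⟨a0, a1, a2, a3, a4⟩ := aux_ang N hN p (by linarith) (by linarith)
  have hN' : (0:ℝ) < N := by positivity
  have hs := aux_Dsum (p/N) N
  rw [div_mul_cancel₀ _ hN'.ne'] at hs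
  have hc := aux_sum N hN u p η h
  set S := ∑ z ∈ Finset.Ico 1 (N+1), u z
  set T := ∑ z ∈ Finset.Ico 1 (N+1), Real.cos (p/N * ((z:ℝ) - 1/2))
  have hsin : Real.sin p < - (p * η) := by
    have : Real.sin p = - Real.sin δ := by rw [hp, add_comm, Real.sin_add_pi]
    have : p ≤ 4 := by linarith
    nlinarith
  have h5 : T < - (N * η) := by
    by_contra hcon
    push Not at hcon
    have : -(p * η) ≤ 2 * Real.sin (p/N/2) * T := by
      calc -(p * η) ≤ -((2 * Real.sin (p/N/2) * N) * η) := by gcongr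
        _ = 2 * Real.sin (p/N/2) * (-(N * η)) := by ring
        _ ≤ 2 * Real.sin (p/N/2) * T := by gcongr
    linarith
  have h6 : Real.cos (p/N/2) * S < 0 := by rw [abs_le] at hc; linarith
  exact (pos_iff_neg_of_mul_neg h6).1 a4

lemma aux_kmono (N : ℕ) (hN : 2 ≤ N) (p q : ℝ) (hp0 : 0 ≤ p) (hpq : p ≤ q) (hq : q ≤ 4) :
    2 - 2 * Real.cos (p/N) ≤ 2 - 2 * Real.cos (q/N) := by
  have hN2 : (2:ℝ) ≤ N := by exact_mod_cast hN
  have hpi := Real.pi_gt_three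
  have : Real.cos (q/N) ≤ Real.cos (p/N) := by
    apply Real.cos_le_cos_of_nonneg_of_le_pi (by positivity)
    · rw [div_le_iff₀ (by positivity)]; nlinarith
    · gcongr
  linarith

lemma aux_kcont (N : ℕ) : Continuous (fun p : ℝ => 2 - 2 * Real.cos (p/N)) := by fun_prop

lemma aux_flux_rec (N : ℕ) (c f : ℕ → ℝ) (lam : ℝ) (hc : ∀ x, 1 ≤ x → x ≤ N - 1 → 0 < c x)
    (h : ∀ x ∈ Finset.Icc 1 N, gen N c f x = -lam * f x) :
    ∀ x, 1 ≤ x → x < N → f (x+1) = f x - lam * (1 / c x) * ∑ z ∈ Finset.Ico 1 (x+1), f z := by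
  intro x h1 h2
  have := aux_gen_flux N c f lam h x h1 h2
  have hcx := hc x h1 (by omega)
  have e : f (x+1) - f x = (- lam * ∑ z ∈ Finset.Ico 1 (x+1), f z) / c x := by
    rw [← this]; field_simp
  have : f (x+1) = f x + (- lam * ∑ z ∈ Finset.Ico 1 (x+1), f z) / c x := by linarith
  rw [this]; ring

lemma aux_gap (N : ℕ) (hN : 2 ≤ N) (c : ℕ → ℝ) (hc : ∀ x, 1 ≤ x → x ≤ N - 1 → 0 < c x)
    (e δ : ℝ) (he0 : 0 ≤ e) (he : e ≤ 1) (hδ : 0 < δ) (hδ1 : δ ≤ 1/2)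
    (heδ : (16 * Real.exp 32) * e < Real.sin δ / 4)
    (hr : ∀ n m : ℕ, 1 ≤ n → n < m → m ≤ N →
      |rsum (fun x => 1 / c x) n m - ((m : ℝ) - (n : ℝ))| ≤ e * N) :
    ∃ p, Real.pi - δ ≤ p ∧ p ≤ Real.pi + δ ∧ spectralGap N c = 2 - 2 * Real.cos (p/N) := by
  have hpi := Real.pi_gt_three
  have hpi' := Real.pi_lt_d2
  have hη0 : 0 ≤ (16 * Real.exp 32) * e := by positivity
  set r : ℕ → ℝ := fun x => 1 / c x with hrdef
  have hshoot : ∀ p : ℝ, 0 ≤ p → p ≤ 4 → ∀ x, 1 ≤ x → x ≤ N →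
      |Real.cos (p/N/2) * (shoot r (2 - 2 * Real.cos (p/N)) (x-1)).1
        - Real.cos (p/N * ((x:ℝ) - 1/2))| ≤ (16 * Real.exp 32) * e := by
    intro p h0 h4
    exact aux_cmp N hN (fun x => (shoot r (2 - 2 * Real.cos (p/N)) (x-1)).1) r p e h0 h4 he0 he hr
      (by simp [shoot]) (fun x hx _ => shoot_rec r _ x hx)
  have hsum : ∀ lam, ∑ z ∈ Finset.Ico 1 (N+1), (shoot r lam (z-1)).1 = (shoot r lam (N-1)).2 := by
    intro lam
    rw [← shoot_sum, show N - 1 + 2 = N + 1 by omega]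
  have hGc : Continuous (fun p : ℝ => (shoot r (2 - 2 * Real.cos (p/N)) (N-1)).2) :=
    continuous_snd.comp ((shoot_cont r (N-1)).comp (aux_kcont N))
  have hpos := aux_pos N hN _ (Real.pi - δ) _ δ (by linarith) hδ hδ1 le_rfl hη0 heδ
    (hshoot (Real.pi - δ) (by linarith) (by linarith))
  have hneg := aux_neg N hN _ (Real.pi + δ) _ δ hδ hδ1 rfl hη0 heδ
    (hshoot (Real.pi + δ) (by linarith) (by linarith))
  rw [hsum] at hpos hneg
  obtain ⟨q, ⟨hq1, hq2⟩, hq⟩ := intermediate_value_Icc' (by linarith : Real.pi - δ ≤ Real.pi + δ)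
    hGc.continuousOn ⟨hneg.le, hpos.le⟩
  simp only at hq
  have hkpos : ∀ p : ℝ, 0 < p → p ≤ 4 → 0 < 2 - 2 * Real.cos (p/N) := by
    intro p h0 h4
    rw [aux_kappa]
    have := (aux_ang N hN p h0 h4).2.2.1
    positivity
  have hmem : (2 - 2 * Real.cos (q/N)) ∈ {lam : ℝ | 0 < lam ∧ IsEigenvalue N c lam} := by
    refine ⟨hkpos q (by linarith) (by linarith), fun x => (shoot r (2 - 2 * Real.cos (q/N)) (x-1)).1,
      ⟨1, Finset.mem_Icc.2 ⟨le_rfl, by omega⟩, by simp [shoot]⟩, ?_⟩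
    apply aux_gen_conv N hN
    · intro x h1 h2
      have hcx := hc x h1 (by omega)
      rw [shoot_rec r _ x h1, hrdef]
      field_simp
      ring
    · rw [hsum, hq]
  have hup : spectralGap N c ≤ 2 - 2 * Real.cos ((Real.pi + δ)/N) :=
    (csInf_le ⟨0, fun _ h => h.1.le⟩ hmem).trans (aux_kmono N hN _ _ (by linarith) hq2 (by linarith))
  have hlow : 2 - 2 * Real.cos ((Real.pi - δ)/N) ≤ spectralGap N c := by
    apply le_csInf ⟨_, hmem⟩
    rintro lam ⟨hl, f, ⟨y, hy, hfy⟩, hf⟩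
    by_contra hcon
    push Not at hcon
    obtain ⟨p, ⟨hp1, hp2⟩, hp⟩ := intermediate_value_Icc (by linarith : 0 ≤ Real.pi - δ)
      (aux_kcont N).continuousOn (⟨by simpa using hl.le, hcon.le⟩ :
        lam ∈ Set.Icc (2 - 2 * Real.cos (0/N)) (2 - 2 * Real.cos ((Real.pi - δ)/N)))
    simp only at hp
    have hp0 : 0 < p := by
      rcases hp1.eq_or_lt with h | h
      · rw [← h] at hp; simp at hp; linarith
      · exact h
    have hrec := aux_flux_rec N c f lam hc hf
    have hf1 : f 1 ≠ 0 := by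
      intro h0
      have : ∀ x, 1 ≤ x → x ≤ N → |f x| ≤ 0 := by
        intro x
        induction x using Nat.strong_induction_on with
        | _ x ih =>
          intro h1 h2
          have R := aux_repr N f _ lam hrec x h1 h2
          rw [R, h0, Finset.sum_eq_zero]
          · simp
          · intro z hz
            rw [Finset.mem_Ico] at hz
            have := abs_nonpos_iff.1 (ih z hz.2 hz.1 (by omega))
            simp [this]
      rw [Finset.mem_Icc] at hy
      exact hfy (abs_nonpos_iff.1 (this y hy.1 hy.2))
    have hcm := aux_cmp N hN (fun x => f x / f 1) r p e hp0.le (by linarith) he0 he hr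
      (div_self hf1) (by
        intro x h1 h2
        rw [← Finset.sum_div, hrec x h1 h2, hp]
        ring)
    have := aux_pos N hN _ p _ δ hp0 hδ hδ1 hp2 hη0 heδ hcm
    rw [← Finset.sum_div] at this
    have h0 := aux_gen_sum N hN c f lam hf
    rcases mul_eq_zero.1 h0 with h | h
    · linarith
    · rw [h] at this; simp at this
  obtain ⟨p, ⟨hp1, hp2⟩, hp⟩ := intermediate_value_Icc (by linarith : Real.pi - δ ≤ Real.pi + δ)
      (aux_kcont N).continuousOn ⟨hlow, hup⟩
  exact ⟨p, hp1, hp2, hp.symm⟩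

lemma aux_main (c : ℕ → ℕ → ℝ) (g : ℕ → ℕ → ℝ)
    (hc : ∀ N, 2 ≤ N → ∀ x, 1 ≤ x → x ≤ N - 1 → 0 < c N x)
    (hLLN : LLN (fun N x => 1 / c N x))
    (hg : ∀ N, 2 ≤ N → ∀ x ∈ Finset.Icc 1 N,
      gen N (c N) (g N) x = -(spectralGap N (c N)) * g N x)
    (hg1 : ∀ N, 2 ≤ N → g N 1 = 1) (s : ℝ) (hs : 0 < s) :
    ∃ N₀ : ℕ, ∀ N ≥ N₀, 2 ≤ N ∧ ∃ p, 0 ≤ p ∧ p ≤ 4 ∧ |p - Real.pi| ≤ s ∧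
      spectralGap N (c N) = 2 - 2 * Real.cos (p/N) ∧
      ∀ x, 1 ≤ x → x ≤ N → |g N x - Real.cos (p/N * ((x:ℝ) - 1/2))| ≤ s := by
  have hpi := Real.pi_gt_three
  have hpi' := Real.pi_lt_d2
  set K := 16 * Real.exp 32 with hK
  have hK0 : 0 < K := by positivity
  set δ := min s (1/2) with hδd
  have hδ : 0 < δ := by positivity
  have hδ1 : δ ≤ 1/2 := min_le_right _ _
  have hsδ : 0 < Real.sin δ := Real.sin_pos_of_pos_of_lt_pi hδ (by linarith)
  set e := min 1 (min (Real.sin δ / 8 / K) (s / 4 / K)) with he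
  have he0 : 0 < e := by positivity
  have he1 : K * e < Real.sin δ / 4 := by
    have : e ≤ Real.sin δ / 8 / K := (min_le_right _ _).trans (min_le_left _ _)
    rw [le_div_iff₀ hK0] at this
    linarith
  have he2 : K * e ≤ s / 4 := by
    have : e ≤ s / 4 / K := (min_le_right _ _).trans (min_le_right _ _)
    rw [le_div_iff₀ hK0] at this
    linarith
  obtain ⟨N₁, hN₁⟩ := hLLN e he0
  obtain ⟨N₂, hN₂⟩ := exists_nat_gt (16 / s)
  refine ⟨max 4 (max N₁ N₂), fun N hN => ?_⟩
  have hN4 : 4 ≤ N := (le_max_left _ _).trans hN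
  have hN1 : N₁ ≤ N := ((le_max_left _ _).trans (le_max_right _ _)).trans hN
  have hN2 : N₂ ≤ N := ((le_max_right _ _).trans (le_max_right _ _)).trans hN
  have h2 : 2 ≤ N := by omega
  have hr := hN₁ N hN1
  obtain ⟨p, hp1, hp2, hp⟩ := aux_gap N h2 (c N) (hc N h2) e δ he0.le (min_le_left _ _) hδ hδ1 he1 hr
  have hδs : δ ≤ s := min_le_left _ _
  refine ⟨h2, p, by linarith, by linarith, by rw [abs_le]; constructor <;> linarith, hp, ?_⟩
  have hgN := hg N h2
  rw [hp] at hgN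
  have hcm := aux_cmp N h2 (g N) _ p e (by linarith) (by linarith) he0.le (min_le_left _ _) hr
    (hg1 N h2) (aux_flux_rec N (c N) (g N) _ (hc N h2) hgN)
  intro x hx hxN
  have h3 := hcm x hx hxN
  have hNs : 16 / s < N := hN₂.trans_le (by exact_mod_cast hN2)
  have hN4' : (4:ℝ) ≤ N := by exact_mod_cast hN4
  have ht : p/N/2 ≤ 2 / N := by
    rw [div_right_comm]; gcongr; linarith
  have ht0 : 0 ≤ p/N/2 := by have : 0 ≤ p := by linarith
                             positivity
  have hcos := Real.one_sub_sq_div_two_le_cos (x := p/N/2)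
  have hcos1 := Real.cos_le_one (p/N/2)
  have hD := Real.abs_cos_le_one (p/N * ((x:ℝ) - 1/2))
  have hNi : 2 / (N:ℝ) ≤ s / 8 := by
    rw [div_lt_iff₀ hs] at hNs
    rw [div_le_div_iff₀ (by linarith) (by norm_num)]; linarith
  have hNi2 : 2 / (N:ℝ) ≤ 1 / 2 := by
    rw [div_le_div_iff₀ (by linarith) (by norm_num)]; linarith
  set C := Real.cos (p/N/2)
  set D := Real.cos (p/N * ((x:ℝ) - 1/2))
  have hC2 : 1 - C ≤ s / 16 := by nlinarith
  have hC3 : 1/2 ≤ C := by nlinarith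
  have hs4 : Real.sin δ ≤ 1 := Real.sin_le_one δ
  have habs : |g N x| ≤ 4 := by
    have h5 : |C * g N x| ≤ 2 := by
      rw [abs_le] at h3 hD ⊢; constructor <;> linarith
    rw [abs_mul, abs_of_nonneg (by linarith)] at h5
    nlinarith [abs_nonneg (g N x)]
  have e1 : g N x - D = (1 - C) * g N x + (C * g N x - D) := by ring
  rw [e1]
  refine (abs_add_le _ _).trans ?_
  rw [abs_mul, abs_of_nonneg (by linarith : 0 ≤ 1 - C)]
  have : (1 - C) * |g N x| ≤ s/16 * 4 := by gcongr
  linarith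

lemma aux_tau (N : ℕ) (r : ℕ → ℝ) (α : ℝ) : tau1 N r α ≤ N := by
  unfold tau1
  split_ifs with h
  · have := Finset.min'_mem _ h
    rw [Finset.mem_filter, Finset.mem_Icc] at this
    exact this.1.2
  · exact le_rfl

lemma aux_cos_lip (a b : ℝ) : |Real.cos a - Real.cos b| ≤ |a - b| :=
  Real.abs_cos_sub_cos_le a b

lemma aux_sin_lip (a b : ℝ) : |Real.sin a - Real.sin b| ≤ |a - b| :=
  Real.abs_sin_sub_sin_le a b

lemma aux_h (N x : ℕ) : hfun N x = Real.cos (Real.pi/N * ((x:ℝ) - 1/2)) := by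
  rw [hfun]; congr 1; ring

lemma aux_fluxdiff (N x : ℕ) (hN : 2 ≤ N) (hx : x ≤ N) (p s : ℝ) (hp0 : 0 ≤ p) (hp : p ≤ 4)
    (h : |p - Real.pi| ≤ s) :
    |(N:ℝ) * (2 * Real.sin (p/N/2) * Real.sin (p/N*x)) -
      N * (2 * Real.sin (Real.pi/N/2) * Real.sin (Real.pi/N*x))| ≤ 5 * s := by
  have hN' : (0:ℝ) < N := by positivity
  have hx' : (x:ℝ) ≤ N := by exact_mod_cast hx
  have h1 : |Real.sin (p/N/2) - Real.sin (Real.pi/N/2)| ≤ s / N / 2 := by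
    refine (aux_sin_lip _ _).trans ?_
    rw [← sub_div, ← sub_div, abs_div, abs_div, abs_of_pos hN', abs_of_pos (two_pos : (0:ℝ) < 2)]
    gcongr
  have hs : 0 ≤ s := (abs_nonneg _).trans h
  have h2 : |Real.sin (p/N*x) - Real.sin (Real.pi/N*x)| ≤ s := by
    refine (aux_sin_lip _ _).trans ?_
    rw [← sub_mul, ← sub_div, abs_mul, abs_div, abs_of_pos hN', Nat.abs_cast, div_mul_eq_mul_div,
      div_le_iff₀ hN']
    gcongr
  have h3 : |Real.sin (p/N/2)| ≤ 2 / N := by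
    have h0 : 0 ≤ p/N/2 := by positivity
    refine Real.abs_sin_le_abs.trans ?_
    rw [abs_of_nonneg h0, div_right_comm]; gcongr; linarith
  have e : (N:ℝ) * (2 * Real.sin (p/N/2) * Real.sin (p/N*x)) -
      N * (2 * Real.sin (Real.pi/N/2) * Real.sin (Real.pi/N*x)) =
      2 * N * (Real.sin (p/N/2) * (Real.sin (p/N*x) - Real.sin (Real.pi/N*x)) +
        (Real.sin (p/N/2) - Real.sin (Real.pi/N/2)) * Real.sin (Real.pi/N*x)) := by ring
  rw [e, abs_mul, abs_of_pos (by positivity : (0:ℝ) < 2 * N)]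
  have h4 := Real.abs_sin_le_one (Real.pi/N*x)
  calc _ ≤ 2 * N * (2 / N * s + s / N / 2 * 1) := by
        gcongr
        refine (abs_add_le _ _).trans ?_
        rw [abs_mul, abs_mul]
        gcongr
    _ = 5 * s := by field_simp; ring

/-- Shape and weighted derivative of the principal eigenfunction on the first
segment `⟦1, τ₁⟧`, with `α_N = N²·gap_N` and `r^{(N)} = 1/c^{(N)}`. -/
theorem eigenfunction_first_segment (c : ℕ → ℕ → ℝ) (g : ℕ → ℕ → ℝ)
    (hc : ∀ N, 2 ≤ N → ∀ x, 1 ≤ x → x ≤ N - 1 → 0 < c N x)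
    (hLLN : LLN (fun N x => 1 / c N x))
    (hg : ∀ N, 2 ≤ N → ∀ x ∈ Finset.Icc 1 N,
      gen N (c N) (g N) x = -(spectralGap N (c N)) * g N x)
    (hg1 : ∀ N, 2 ≤ N → g N 1 = 1) :
    (∀ ε > (0 : ℝ), ∃ N₀ : ℕ, ∀ N ≥ N₀, ∀ x : ℕ, 1 ≤ x →
      x ≤ tau1 N (fun y => 1 / c N y) ((N : ℝ) ^ 2 * spectralGap N (c N)) →
        |g N x - hfun N x| < ε) ∧
    (∀ ε > (0 : ℝ), ∃ N₀ : ℕ, ∀ N ≥ N₀, ∀ x : ℕ, 2 ≤ x →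
      x ≤ tau1 N (fun y => 1 / c N y) ((N : ℝ) ^ 2 * spectralGap N (c N)) →
        |(N : ℝ) * c N (x - 1) * (g N x - g N (x - 1)) -
          (N : ℝ) * (hfun N x - hfun N (x - 1))| < ε) := by
  constructor
  · intro ε hε
    obtain ⟨N₀, h0⟩ := aux_main c g hc hLLN hg hg1 (ε/3) (by positivity)
    refine ⟨N₀, fun N hN x hx hxt => ?_⟩
    have hxN := hxt.trans (aux_tau _ _ _)
    obtain ⟨h2, p, hp0, hp4, hp, -, hcl⟩ := h0 N hN
    have h3 := hcl x hx hxN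
    have hN' : (0:ℝ) < N := by positivity
    have hx1 : (1:ℝ) ≤ x := by exact_mod_cast hx
    have hx' : (x:ℝ) ≤ N := by exact_mod_cast hxN
    have h4 : |Real.cos (p/N * ((x:ℝ) - 1/2)) - hfun N x| ≤ ε/3 := by
      rw [aux_h]
      refine (aux_cos_lip _ _).trans ?_
      rw [← sub_mul, ← sub_div, abs_mul, abs_div, abs_of_pos hN',
        abs_of_pos (by linarith : (0:ℝ) < x - 1/2), div_mul_eq_mul_div, div_le_iff₀ hN']
      exact mul_le_mul hp (by linarith) (by linarith) (by positivity)
    have := abs_sub_le (g N x) (Real.cos (p/N * ((x:ℝ) - 1/2))) (hfun N x)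
    linarith
  · intro ε hε
    obtain ⟨N₀, h0⟩ := aux_main c g hc hLLN hg hg1 (ε/22) (by positivity)
    refine ⟨N₀, fun N hN x hx hxt => ?_⟩
    have hxN := hxt.trans (aux_tau _ _ _)
    obtain ⟨h2, p, hp0, hp4, hp, hgap, hcl⟩ := h0 N hN
    obtain ⟨y, rfl⟩ : ∃ y, x = y + 1 := ⟨x - 1, by omega⟩
    have hgN := hg N h2
    rw [hgap] at hgN
    have hfl := aux_gen_flux N (c N) (g N) _ hgN y (by omega) (by omega)
    obtain ⟨hk0, hk⟩ := aux_kappa_le N h2 p hp0 hp4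
    have hN' : (0:ℝ) < N := by positivity
    rw [Nat.add_sub_cancel, mul_assoc, hfl, aux_h, aux_h, aux_Dstep]
    have hfd := aux_fluxdiff N y h2 (by omega) p _ hp0 hp4 hp
    have hDs := aux_Dsum (p/N) y
    have hsum : |∑ z ∈ Finset.Ico 1 (y+1), g N z -
        ∑ z ∈ Finset.Ico 1 (y+1), Real.cos (p/N * ((z:ℝ) - 1/2))| ≤ N * (ε/22) := by
      rw [← Finset.sum_sub_distrib]
      refine (Finset.abs_sum_le_sum_abs _ _).trans ?_
      refine (Finset.sum_le_sum (g := fun _ => ε/22) ?_).trans ?_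
      · intro z hz
        rw [Finset.mem_Ico] at hz
        exact hcl z hz.1 (by omega)
      · simp only [Finset.sum_const, Nat.card_Ico, nsmul_eq_mul, Nat.add_sub_cancel]
        have : (y:ℝ) ≤ N := by exact_mod_cast (by omega : y ≤ N)
        gcongr
    have hkk := aux_kappa (p/N)
    set S := ∑ z ∈ Finset.Ico 1 (y+1), g N z
    set T := ∑ z ∈ Finset.Ico 1 (y+1), Real.cos (p/N * ((z:ℝ) - 1/2))
    set k := 2 - 2 * Real.cos (p/N)
    have hT : 2 * Real.sin (p/N/2) * Real.sin (p/N*y) = k * T := by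
      rw [← hDs, hkk]; ring
    rw [hT] at hfd
    have e : (N:ℝ) * (-k * S) - N * (Real.cos (Real.pi/N * ((y:ℝ) - 1/2))
        - 2 * Real.sin (Real.pi/N/2) * Real.sin (Real.pi/N*y) - Real.cos (Real.pi/N * ((y:ℝ) - 1/2)))
        = -(N * k * (S - T)) - (N * (k * T) - N * (2 * Real.sin (Real.pi/N/2) * Real.sin (Real.pi/N*y))) := by
      ring
    rw [e]
    refine (abs_sub _ _).trans_lt ?_
    have h5 : |-(N * k * (S - T))| ≤ 16 * (ε/22) := by
      rw [abs_neg, abs_mul, abs_of_nonneg (by positivity : 0 ≤ N * k)]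
      calc N * k * |S - T| ≤ N * k * (N * (ε/22)) := by gcongr
        _ = (k * N^2) * (ε/22) := by ring
        _ ≤ _ := by gcongr
    linarith
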